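/- arXiv:2512.07137 — 6 statements merged into one kernel-verified Lean document; each statement's English description precedes it below -/
import Mathlib

section
/- Let n ≥ 1 and let A be an n×n real matrix with nonnegative entries and zero diagonal, viewed as the weighted adjacency matrix of a directed graph on nodes {1,…,n} in which there is a directed edge from node j to node i exactly when A_{ij} > 0. Let L be the associated Laplacian matrix, defined by L_{ii} = Σ_{j} A_{ij} and L_{ij} = −A_{ij} for i ≠ j. Then rank(L) = n − 1 if and only if the directed graph has a directed spanning tree, i.e., there exists a node r from which every node is reachable along directed edges (reachability being the reflexive–transitive closure of the edge relation). -/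
/-- An `n × n` matrix over a field, `n ≥ 1`, has rank `n - 1` iff its kernel is a line. -/
theorem Matrix.rank_eq_pred_iff_finrank_ker {K : Type*} [Field K] {n : ℕ} (hn : 1 ≤ n)
    (M : Matrix (Fin n) (Fin n) K) :
    M.rank = n - 1 ↔ Module.finrank K (LinearMap.ker M.mulVecLin) = 1 := by
  have h := LinearMap.finrank_range_add_finrank_ker M.mulVecLin
  rw [Module.finrank_fin_fun] at h
  rw [Matrix.rank]
  omega

open Matrix in
/-- If the rows indexed by a nonempty set `S` vanish outside the columns in `S` and sum to zero,
then they satisfy a nontrivial linear relation. -/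
theorem Matrix.exists_vecMul_eq_zero_of_supported {K ι : Type*} [Field K] [Fintype ι]
    (M : Matrix ι ι K) (S : Set ι) (hS : S.Nonempty)
    (hsum : ∀ i ∈ S, ∑ j, M i j = 0) (hsupp : ∀ i ∈ S, ∀ j ∉ S, M i j = 0) :
    ∃ y : ι → K, y ≠ 0 ∧ (∀ i ∉ S, y i = 0) ∧ y ᵥ* M = 0 := by
  classical
  let N : Matrix ι ι K := fun i j => if i ∈ S then M i j else if i = j then 1 else 0
  have hdet : N.det = 0 := by
    refine Matrix.exists_mulVec_eq_zero_iff.1 ⟨S.indicator 1, ?_, ?_⟩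
    · obtain ⟨s, hs⟩ := hS
      intro h
      simpa [hs] using congrFun h s
    · ext i
      by_cases hi : i ∈ S
      · rw [Pi.zero_apply, ← hsum i hi]
        refine Finset.sum_congr rfl fun j _ => ?_
        by_cases hj : j ∈ S <;> simp [N, hi, hj, hsupp i hi]
      · simp [Matrix.mulVec, dotProduct, N, hi]
  obtain ⟨y, hy, hyN⟩ := Matrix.exists_vecMul_eq_zero_iff.2 hdet
  have hoff : ∀ j ∉ S, y j = 0 := by
    intro j hj
    have h : ∑ i, y i * N i j = y j * N j j :=
      Finset.sum_eq_single j
        (fun i _ hij => by by_cases hi : i ∈ S <;> simp [N, hi, hij, hsupp i, hj]) (by simp)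
    have h0 : ∑ i, y i * N i j = 0 := congrFun hyN j
    simpa [N, hj] using h.symm.trans h0
  refine ⟨y, hy, hoff, ?_⟩
  rw [← hyN]
  ext j
  refine Finset.sum_congr rfl fun i _ => ?_
  by_cases hi : i ∈ S <;> simp [N, hi, hoff i]

/-- In a finite type, either some element is related to everything by a preorder relation, or
there are two disjoint nonempty sets closed under predecessors. -/
theorem exists_root_or_disjoint_predecessor_closed {ι : Type*} [Finite ι] [Nonempty ι]
    (e : ι → ι → Prop) :
    (∃ r, ∀ i, Relation.ReflTransGen e r i) ∨
      ∃ S T : Set ι, S.Nonempty ∧ T.Nonempty ∧ Disjoint S T ∧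
        (∀ j i, e j i → i ∈ S → j ∈ S) ∧ (∀ j i, e j i → i ∈ T → j ∈ T) := by
  obtain ⟨r, hr⟩ := Finite.exists_min fun v => {j | Relation.ReflTransGen e j v}.ncard
  by_cases h : ∀ i, Relation.ReflTransGen e r i
  · exact Or.inl ⟨r, h⟩
  push Not at h
  refine Or.inr ⟨{j | Relation.ReflTransGen e j r}, {i | ¬ Relation.ReflTransGen e r i},
    ⟨r, .refl⟩, h, ?_, fun j i hji hi => .head hji hi, fun j i hji hi hj => hi (hj.tail hji)⟩
  rw [Set.disjoint_left]
  intro j hj hrj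
  have heq : {k | Relation.ReflTransGen e k j} = {k | Relation.ReflTransGen e k r} :=
    Set.eq_of_subset_of_ncard_le (fun k hk => Relation.ReflTransGen.trans hk hj) (hr j)
      (Set.toFinite _)
  have hr_mem : r ∈ {k | Relation.ReflTransGen e k r} := .refl
  rw [← heq] at hr_mem
  exact hrj hr_mem

/-- If the weighted differences `∑ j, A i j * (x i - x j)` all vanish, then the maximum of `x` is
attained at every node from which all nodes can be reached. -/
theorem le_root_of_sum_mul_sub_eq_zero {ι : Type*} [Fintype ι] (A : Matrix ι ι ℝ)
    (hA : ∀ i j, 0 ≤ A i j) {r : ι}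
    (hr : ∀ i, Relation.ReflTransGen (fun j i => 0 < A i j) r i)
    (x : ι → ℝ) (hx : ∀ i, ∑ j, A i j * (x i - x j) = 0) (k : ι) : x k ≤ x r := by
  have : Nonempty ι := ⟨r⟩
  obtain ⟨m, hm⟩ := Finite.exists_max x
  suffices h : ∀ k, x k ≤ x r from h k
  refine (hr m).head_induction_on hm fun {j i} hji _ hi => ?_
  have h0 := (Finset.sum_eq_zero_iff_of_nonneg fun j _ =>
    mul_nonneg (hA i j) (sub_nonneg.2 (hi j))).1 (hx i) j (Finset.mem_univ j)
  have hij : x i = x j := sub_eq_zero.1 ((mul_eq_zero.1 h0).resolve_left hji.ne')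
  exact fun k => hij ▸ hi k

/-- Rank of the Laplacian of a weighted directed graph is `n - 1` iff the graph
has a directed spanning tree (a root from which all nodes are reachable). -/
theorem laplacian_rank_eq_iff_spanning_tree (n : ℕ) (hn : 1 ≤ n)
    (A : Matrix (Fin n) (Fin n) ℝ)
    (hA : ∀ i j, 0 ≤ A i j) (hdiag : ∀ i, A i i = 0)
    (L : Matrix (Fin n) (Fin n) ℝ)
    (hL : ∀ i j, L i j = if i = j then ∑ k, A i k else -A i j) :
    L.rank = n - 1 ↔
      ∃ r : Fin n, ∀ i : Fin n,
        Relation.ReflTransGen (fun j i : Fin n => 0 < A i j) r i := by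
  have : Nonempty (Fin n) := ⟨⟨0, hn⟩⟩
  have hmul : ∀ x i, (L.mulVec x) i = ∑ j, A i j * (x i - x j) := by
    intro x i
    have hL' : ∀ j, L i j = (if i = j then ∑ k, A i k else 0) - A i j := by
      intro j
      rw [hL]
      split_ifs with h
      · subst h; simp [hdiag]
      · simp
    simp [Matrix.mulVec, dotProduct, hL', sub_mul, mul_sub, Finset.sum_sub_distrib,
      Finset.sum_mul]
  have hrow : ∀ i, ∑ j, L i j = 0 := by
    intro i
    simpa [Matrix.mulVec, dotProduct] using hmul 1 i
  constructor
  · intro hrank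
    refine (exists_root_or_disjoint_predecessor_closed _).resolve_right ?_
    rintro ⟨S, T, hS, hT, hST, hSc, hTc⟩
    have key : ∀ U : Set (Fin n), (∀ j i, 0 < A i j → i ∈ U → j ∈ U) →
        ∀ i ∈ U, ∀ j ∉ U, L i j = 0 := by
      intro U hU i hi j hj
      have hij : i ≠ j := by rintro rfl; exact hj hi
      rw [hL, if_neg hij, neg_eq_zero]
      exact le_antisymm (not_lt.1 fun h => hj (hU j i h hi)) (hA i j)
    obtain ⟨y, hy, hyS, hyL⟩ :=
      L.exists_vecMul_eq_zero_of_supported S hS (fun i _ => hrow i) (key S hSc)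
    obtain ⟨z, hz, hzT, hzL⟩ :=
      L.exists_vecMul_eq_zero_of_supported T hT (fun i _ => hrow i) (key T hTc)
    rw [← Matrix.rank_transpose, Matrix.rank_eq_pred_iff_finrank_ker hn] at hrank
    have hker : ∀ v, Matrix.vecMul v L = 0 → v ∈ LinearMap.ker L.transpose.mulVecLin := by
      intro v hv
      simpa [Matrix.mulVec_transpose] using hv
    obtain ⟨c, hc⟩ := (finrank_eq_one_iff_of_nonzero' (⟨y, hker y hyL⟩ :
      LinearMap.ker L.transpose.mulVecLin) (by simpa using hy)).1 hrank ⟨z, hker z hzL⟩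
    have hc' : c • y = z := congrArg Subtype.val hc
    apply hz
    ext i
    by_cases hi : i ∈ S
    · exact hzT i (Set.disjoint_left.1 hST hi)
    · simp [← hc', hyS i hi]
  · rintro ⟨r, hr⟩
    rw [Matrix.rank_eq_pred_iff_finrank_ker hn]
    have hone : (1 : Fin n → ℝ) ∈ LinearMap.ker L.mulVecLin := by
      ext i
      simp [hmul]
    refine (finrank_eq_one_iff_of_nonzero' (⟨1, hone⟩ : LinearMap.ker L.mulVecLin)
      (by simp)).2 ?_
    rintro ⟨x, hx⟩
    have hx' : ∀ i, ∑ j, A i j * (x i - x j) = 0 := fun i => hmul x i ▸ congrFun hx i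
    have hneg : ∀ i, ∑ j, A i j * ((-x) i - (-x) j) = 0 := by
      intro i
      rw [← neg_eq_zero, ← hx' i, ← Finset.sum_neg_distrib]
      refine Finset.sum_congr rfl fun j _ => ?_
      simp only [Pi.neg_apply]
      ring
    refine ⟨x r, Subtype.ext (funext fun i => ?_)⟩
    have h1 := le_root_of_sum_mul_sub_eq_zero A hA hr x hx' i
    have h2 := le_root_of_sum_mul_sub_eq_zero A hA hr (-x) hneg i
    simp only [Pi.neg_apply, neg_le_neg_iff] at h2
    simpa using le_antisymm h2 h1
end

section
/- Let λ be a complex number with Re(λ) ≥ 0 and let α > 0, β > 0 be real numbers. Then every complex root z of the quadratic z² + α(λ + 1)z + β(λ + 1) = 0 satisfies Re(z) < 0 if and only if β·(Im λ)² < α²·((Re λ + 1)·(Im λ)² + (Re λ + 1)³). -/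
theorem Complex.exists_add_eq_and_mul_eq (a b : ℂ) : ∃ u v : ℂ, u + v = a ∧ u * v = b := by
  obtain ⟨d, hd⟩ := IsAlgClosed.exists_pow_nat_eq (a ^ 2 - 4 * b) (n := 2) (by norm_num)
  exact ⟨(a + d) / 2, (a - d) / 2, by ring, by linear_combination -(1 / 4 : ℂ) * hd⟩

/-- The Routh-Hurwitz criterion for a monic complex quadratic, in terms of its roots `u`, `v`. -/
theorem Complex.re_neg_and_re_neg_iff {u v : ℂ} (h : (u + v).re < 0) :
    (u.re < 0 ∧ v.re < 0) ↔
      0 < (u + v).re ^ 2 * (u * v).re + (u + v).re * (u + v).im * (u * v).im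
        - (u * v).im ^ 2 := by
  have key : (u + v).re ^ 2 * (u * v).re + (u + v).re * (u + v).im * (u * v).im
      - (u * v).im ^ 2 = u.re * v.re * ((u + v).re ^ 2 + (u.im - v.im) ^ 2) := by
    simp only [Complex.add_re, Complex.add_im, Complex.mul_re, Complex.mul_im]
    ring
  have hpos : 0 < (u + v).re ^ 2 + (u.im - v.im) ^ 2 := by
    have := pow_pos (neg_pos.2 h) 2
    nlinarith [sq_nonneg (u.im - v.im)]
  rw [key, mul_pos_iff_of_pos_right hpos]
  rw [Complex.add_re] at h
  refine ⟨fun ⟨hu, hv⟩ => mul_pos_of_neg_of_neg hu hv, fun huv => ?_⟩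
  rcases mul_pos_iff.1 huv with ⟨hu, hv⟩ | huv
  · linarith
  · exact huv

theorem quadratic_roots_re_neg_iff (lam : ℂ) (hlam : 0 ≤ lam.re)
    (α β : ℝ) (hα : 0 < α) (hβ : 0 < β) :
    (∀ z : ℂ, z ^ 2 + (α : ℂ) * (lam + 1) * z + (β : ℂ) * (lam + 1) = 0 → z.re < 0) ↔
      β * lam.im ^ 2 < α ^ 2 * ((lam.re + 1) * lam.im ^ 2 + (lam.re + 1) ^ 3) := by
  obtain ⟨u, v, hadd, hmul⟩ :=
    Complex.exists_add_eq_and_mul_eq (-((α : ℂ) * (lam + 1))) ((β : ℂ) * (lam + 1))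
  have hroots : (∀ z : ℂ, z ^ 2 + (α : ℂ) * (lam + 1) * z + (β : ℂ) * (lam + 1) = 0 →
      z.re < 0) ↔ u.re < 0 ∧ v.re < 0 := by
    have hfactor (z : ℂ) : z ^ 2 + (α : ℂ) * (lam + 1) * z + (β : ℂ) * (lam + 1)
        = (z - u) * (z - v) := by
      linear_combination z * hadd - hmul
    simp [hfactor, sub_eq_zero, or_imp, forall_and]
  have hneg : (u + v).re < 0 := by
    have : 0 < α * (lam.re + 1) := by positivity
    simpa [hadd] using this
  rw [hroots, Complex.re_neg_and_re_neg_iff hneg, hadd, hmul, ← sub_pos (b := β * lam.im ^ 2),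
    ← mul_pos_iff_of_pos_left (b := _ - β * lam.im ^ 2) hβ]
  simp only [Complex.neg_re, Complex.neg_im, Complex.re_ofReal_mul, Complex.im_ofReal_mul,
    Complex.add_re, Complex.add_im, Complex.one_re, Complex.one_im, add_zero]
  ring_nf
end

section
/- Let M be an m×m complex matrix and α, β complex numbers. A complex number s is an eigenvalue of the 2m×2m block matrix [[0, I], [−β·M, −α·M]] (with m×m blocks) if and only if there exists an eigenvalue λ of M such that s² + α·λ·s + β·λ = 0. -/
namespace Matrix

variable {n R : Type*} [Fintype n] [DecidableEq n] [CommRing R]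

theorem det_fromBlocks_smul_one_neg_one_eq_zero_iff (s : R) (C D : Matrix n n R) :
    (fromBlocks (s • (1 : Matrix n n R)) (-1) C D).det = 0 ↔ (C + s • D).det = 0 := by
  set U : Matrix (n ⊕ n) (n ⊕ n) R := fromBlocks 0 1 (-1) (s • 1)
  have hUV : U * fromBlocks (s • 1) (-1) 1 0 = 1 := by
    simp [U, fromBlocks_multiply, ← fromBlocks_one]
  have hU : IsUnit U.det := (isUnit_iff_isUnit_det U).1 (.of_mul_eq_one _ hUV)
  have hprod : fromBlocks (s • (1 : Matrix n n R)) (-1) C D * U =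
      fromBlocks 1 0 (-D) (C + s • D) := by
    simp [U, fromBlocks_multiply]
  rw [← hU.mul_left_eq_zero, ← det_mul, hprod, det_fromBlocks_zero₁₂, det_one, one_mul]

theorem isRoot_charpoly_iff_det (A : Matrix n n R) (s : R) :
    A.charpoly.IsRoot s ↔ (s • (1 : Matrix n n R) - A).det = 0 := by
  rw [Polynomial.IsRoot, eval_charpoly, scalar_apply, smul_one_eq_diagonal]

theorem det_smul_one_add_smul_eq_zero_iff {K : Type*} [Field K] [IsAlgClosed K]
    (M : Matrix n n K) (a b : K) :
    (a • (1 : Matrix n n K) + b • M).det = 0 ↔ ∃ l : K, M.charpoly.IsRoot l ∧ a + b * l = 0 := by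
  cases isEmpty_or_nonempty n
  · simp [Polynomial.IsRoot, charpoly_isEmpty]
  have h := spectrum.map_polynomial_aeval_of_nonempty M
    (Polynomial.C a + Polynomial.C b * Polynomial.X)
    (spectrum.nonempty_of_isAlgClosed_of_finiteDimensional K M)
  have h0 := Set.ext_iff.1 h 0
  simpa [spectrum.zero_mem_iff, isUnit_iff_isUnit_det, mem_spectrum_iff_isRoot_charpoly,
    Algebra.algebraMap_eq_smul_one, ← Algebra.smul_def] using h0

end Matrix

theorem block_eigenvalue_iff (m : ℕ) (M : Matrix (Fin m) (Fin m) ℂ) (α β s : ℂ) :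
    (Matrix.fromBlocks (0 : Matrix (Fin m) (Fin m) ℂ) 1
        (-(β • M)) (-(α • M))).charpoly.IsRoot s ↔
      ∃ lam : ℂ, M.charpoly.IsRoot lam ∧ s ^ 2 + α * lam * s + β * lam = 0 := by
  have hblocks : s • (1 : Matrix (Fin m ⊕ Fin m) (Fin m ⊕ Fin m) ℂ) -
      Matrix.fromBlocks 0 1 (-(β • M)) (-(α • M)) =
      Matrix.fromBlocks (s • 1) (-1) (β • M) (s • 1 + α • M) := by
    rw [← Matrix.fromBlocks_one, Matrix.fromBlocks_smul, sub_eq_add_neg,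
      Matrix.fromBlocks_neg, Matrix.fromBlocks_add]
    simp
  have hpencil : β • M + s • (s • 1 + α • M) = s ^ 2 • 1 + (α * s + β) • M := by
    module
  rw [Matrix.isRoot_charpoly_iff_det, hblocks,
    Matrix.det_fromBlocks_smul_one_neg_one_eq_zero_iff, hpencil,
    Matrix.det_smul_one_add_smul_eq_zero_iff]
  refine exists_congr fun l => and_congr_right fun _ => ?_
  rw [show s ^ 2 + (α * s + β) * l = s ^ 2 + α * l * s + β * l by ring]
end

section
/- Let L be an N×N real matrix all of whose complex eigenvalues λ satisfy Re(λ) ≥ 0, and let α > 0, β > 0 be real numbers. Then every complex eigenvalue s of the 2N×2N real block matrix [[0, I], [−β·(L + I), −α·(L + I)]] satisfies Re(s) < 0 if and only if every complex eigenvalue λ of L satisfies β·(Im λ)² < α²·((Re λ + 1)·(Im λ)² + (Re λ + 1)³). -/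
theorem Matrix.charpoly_isRoot_iff_exists_mulVec {n : Type*} [Fintype n] [DecidableEq n]
    (A : Matrix n n ℂ) (t : ℂ) :
    A.charpoly.IsRoot t ↔ ∃ v, v ≠ 0 ∧ A.mulVec v = t • v := by
  rw [Polynomial.IsRoot, Matrix.eval_charpoly, ← Matrix.exists_mulVec_eq_zero_iff]
  refine exists_congr fun v => and_congr_right fun _ => ?_
  rw [Matrix.sub_mulVec, sub_eq_zero, Matrix.scalar_apply, ← Matrix.smul_one_eq_diagonal,
    Matrix.smul_mulVec, Matrix.one_mulVec, eq_comm]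

/-- The eigenvalues of the block companion matrix of `L + 1` are the roots of the quadratics
attached to the eigenvalues of `L`. -/
theorem Matrix.fromBlocks_companion_charpoly_isRoot_iff {n : Type*} [Fintype n] [DecidableEq n]
    (L : Matrix n n ℝ) (α β : ℝ) (hβ : β ≠ 0) (s : ℂ) :
    ((Matrix.fromBlocks (0 : Matrix n n ℝ) 1
        (-(β • (L + 1))) (-(α • (L + 1)))).map Complex.ofReal).charpoly.IsRoot s ↔
      ∃ lam : ℂ, (L.map Complex.ofReal).charpoly.IsRoot lam ∧
        s ^ 2 + α * (lam + 1) * s + β * (lam + 1) = 0 := by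
  have hmap : (Matrix.fromBlocks (0 : Matrix n n ℝ) 1
      (-(β • (L + 1))) (-(α • (L + 1)))).map Complex.ofReal =
      Matrix.fromBlocks (0 : Matrix n n ℂ) 1
        (-((β : ℂ) • (L.map Complex.ofReal + 1))) (-((α : ℂ) • (L.map Complex.ofReal + 1))) := by
    rw [Matrix.fromBlocks_map]
    congr 1 <;> ext i j <;> by_cases h : i = j <;> simp [Matrix.one_apply, h]
  rw [hmap]
  generalize L.map Complex.ofReal = A
  simp only [Matrix.charpoly_isRoot_iff_exists_mulVec]
  constructor
  · rintro ⟨v, hv, hvs⟩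
    rw [Matrix.fromBlocks_mulVec] at hvs
    have h₁ : ∀ i, v (Sum.inr i) = s * v (Sum.inl i) := fun i => by
      simpa using congrFun hvs (Sum.inl i)
    have hr : v ∘ Sum.inr = s • (v ∘ Sum.inl) := funext h₁
    have h₂ : ∀ i, -(β * (A.mulVec (v ∘ Sum.inl) i + v (Sum.inl i))) -
        α * s * (A.mulVec (v ∘ Sum.inl) i + v (Sum.inl i)) = s * (s * v (Sum.inl i)) := fun i => by
      have := congrFun hvs (Sum.inr i)
      simp only [hr, Sum.elim_inr, Pi.add_apply, Matrix.neg_mulVec, Matrix.smul_mulVec,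
        Matrix.add_mulVec, Matrix.one_mulVec, Matrix.mulVec_smul, Pi.neg_apply, Pi.smul_apply,
        smul_eq_mul, Function.comp_apply, h₁] at this
      linear_combination this
    have hx : v ∘ Sum.inl ≠ 0 := fun h => hv <| by
      have h₀ : ∀ i, v (Sum.inl i) = 0 := congrFun h
      ext (i | i)
      · exact h₀ i
      · simp [h₁, h₀]
    have hd : (β + α * s : ℂ) ≠ 0 := fun h => by
      obtain ⟨i, hi⟩ := Function.ne_iff.mp hx
      have hs : s = 0 := by
        have : s * (s * v (Sum.inl i)) = 0 := by
          rw [← h₂ i]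
          linear_combination -(A.mulVec (v ∘ Sum.inl) i + v (Sum.inl i)) * h
        simpa [show v (Sum.inl i) ≠ 0 from hi] using this
      apply hβ
      simpa [hs] using h
    have hq : -s ^ 2 / (β + α * s) * (β + α * s) = -s ^ 2 := div_mul_cancel₀ _ hd
    refine ⟨-s ^ 2 / (β + α * s) - 1, ⟨v ∘ Sum.inl, hx, funext fun i => mul_left_cancel₀ hd ?_⟩, ?_⟩
    · simp only [Pi.smul_apply, smul_eq_mul, Function.comp_apply]
      linear_combination -h₂ i - v (Sum.inl i) * hq
    · linear_combination hq
  · rintro ⟨lam, ⟨x, hx, hlam⟩, hs⟩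
    refine ⟨Sum.elim x (s • x), fun h => hx (funext fun i => congrFun h (Sum.inl i)), ?_⟩
    rw [Matrix.fromBlocks_mulVec]
    ext (i | i)
    · simp
    · simp only [Sum.elim_comp_inl, Sum.elim_comp_inr, Sum.elim_inr, Pi.add_apply,
        Matrix.neg_mulVec, Matrix.smul_mulVec, Matrix.add_mulVec, Matrix.one_mulVec,
        Matrix.mulVec_smul, Pi.neg_apply, Pi.smul_apply, smul_eq_mul, hlam]
      linear_combination -(x i) * hs

/-- A Hurwitz criterion for the quadratic `s² + αμs + βμ` with `μ` in the open right
half-plane. -/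
theorem Complex.quadratic_hurwitz_iff (α β : ℝ) (hα : 0 < α) (hβ : 0 < β) (μ : ℂ)
    (hμ : 0 < μ.re) :
    (∀ s : ℂ, s ^ 2 + α * μ * s + β * μ = 0 → s.re < 0) ↔
      β * μ.im ^ 2 < α ^ 2 * (μ.re * μ.im ^ 2 + μ.re ^ 3) := by
  obtain ⟨a, b⟩ := μ
  simp only at hμ ⊢
  have hroot : ∀ x y : ℝ, (⟨x, y⟩ : ℂ) ^ 2 + α * ⟨a, b⟩ * ⟨x, y⟩ + β * ⟨a, b⟩ = 0 ↔
      x ^ 2 - y ^ 2 + α * (a * x - b * y) + β * a = 0 ∧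
        y * (2 * x + α * a) = -b * (α * x + β) := fun x y => by
    rw [Complex.ext_iff]
    simp only [sq, Complex.add_re, Complex.mul_re, Complex.ofReal_re, Complex.ofReal_im,
      Complex.add_im, Complex.mul_im, Complex.zero_re, Complex.zero_im]
    constructor <;> rintro ⟨h₁, h₂⟩ <;> constructor <;> linarith
  -- the polynomial in `x = re s` obtained by eliminating `y = im s`
  let P : ℝ → ℝ := fun x => (x ^ 2 + α * a * x + β * a) * (2 * x + α * a) ^ 2 +
    b ^ 2 * (α * x + β) * (α * x + α ^ 2 * a - β)
  constructor
  · intro h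
    by_contra! hc
    have hP₀ : P 0 ≤ 0 := by
      have := mul_le_mul_of_nonneg_left hc hβ.le
      simp only [P]
      linarith
    have hP₁ : 0 ≤ P (β / α) := by
      have : α * (β / α) = β := by field_simp
      have : 0 ≤ α * (β / α) + α ^ 2 * a - β := by rw [this]; ring_nf; positivity
      simp only [P]
      positivity
    have hcont : Continuous P := by fun_prop
    obtain ⟨x, ⟨hx, -⟩, hPx⟩ :=
      intermediate_value_Icc (div_pos hβ hα).le hcont.continuousOn ⟨hP₀, hP₁⟩
    have hD : 2 * x + α * a ≠ 0 := by positivity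
    refine absurd (h ⟨x, -b * (α * x + β) / (2 * x + α * a)⟩ ((hroot _ _).2 ⟨?_, ?_⟩)) hx.not_gt
    · simp only [P] at hPx
      field_simp
      linear_combination hPx
    · field_simp
  · rintro h ⟨x, y⟩ hs
    obtain ⟨h₁, h₂⟩ := (hroot x y).1 hs
    by_contra! hx
    simp only at hx
    have hPx : P x = 0 := by
      simp only [P]
      linear_combination (2 * x + α * a) ^ 2 * h₁ +
        (y * (2 * x + α * a) - b * (α * x + β) + α * b * (2 * x + α * a)) * h₂
    have hP₀ : 0 < P 0 := by
      have := mul_lt_mul_of_pos_left h hβ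
      simp only [P]
      linarith
    have hmono : 0 ≤ P x - P 0 := by
      have : P x - P 0 = (x ^ 2 + α * a * x) * (2 * x + α * a) ^ 2 +
          β * a * (4 * x ^ 2 + 4 * x * α * a) + b ^ 2 * (α ^ 2 * x ^ 2 + α ^ 3 * a * x) := by
        simp only [P]
        ring
      rw [this]
      positivity
    linarith

theorem block_matrix_hurwitz_iff (N : ℕ) (L : Matrix (Fin N) (Fin N) ℝ)
    (α β : ℝ) (hα : 0 < α) (hβ : 0 < β)
    (hspec : ∀ lam : ℂ, (L.map Complex.ofReal).charpoly.IsRoot lam → 0 ≤ lam.re) :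
    (∀ s : ℂ,
        ((Matrix.fromBlocks (0 : Matrix (Fin N) (Fin N) ℝ) 1
            (-(β • (L + 1))) (-(α • (L + 1)))).map Complex.ofReal).charpoly.IsRoot s →
          s.re < 0) ↔
      ∀ lam : ℂ, (L.map Complex.ofReal).charpoly.IsRoot lam →
        β * lam.im ^ 2 < α ^ 2 * ((lam.re + 1) * lam.im ^ 2 + (lam.re + 1) ^ 3) := by
  have hquad : ∀ lam : ℂ, (L.map Complex.ofReal).charpoly.IsRoot lam →
      ((∀ s : ℂ, s ^ 2 + α * (lam + 1) * s + β * (lam + 1) = 0 → s.re < 0) ↔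
        β * lam.im ^ 2 < α ^ 2 * ((lam.re + 1) * lam.im ^ 2 + (lam.re + 1) ^ 3)) :=
    fun lam hlam => by
      have := hspec lam hlam
      simpa using Complex.quadratic_hurwitz_iff α β hα hβ (lam + 1) (by simp; linarith)
  simp only [Matrix.fromBlocks_companion_charpoly_isRoot_iff L α β hβ.ne']
  constructor
  · intro h lam hlam
    exact (hquad lam hlam).1 fun s hs => h s ⟨lam, hlam, hs⟩
  · rintro h s ⟨lam, hlam, hs⟩
    exact (hquad lam hlam).2 (h lam hlam) s hs
end

section
/- Let n ≥ 0 and let L be an (n+1)×(n+1) real matrix with L·1 = 0 (each row sums to zero) and rank(L) = n, and let P be a Moore–Penrose pseudoinverse of L. Then P·L = I − (1/(n+1))·1·1ᵀ, where 1 is the all-ones column vector of length n+1. -/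
open Matrix

/-- If `L` has corank one and annihilates the all-ones vector, its kernel consists of the
constant vectors. -/
theorem exists_const_of_mulVec_eq_zero {n : ℕ} {L : Matrix (Fin (n + 1)) (Fin (n + 1)) ℝ}
    (hL1 : L.mulVec (fun _ => 1) = 0) (hrank : L.rank = n)
    {v : Fin (n + 1) → ℝ} (hv : L.mulVec v = 0) : ∃ c : ℝ, ∀ i, v i = c := by
  have hker : Module.finrank ℝ (LinearMap.ker L.mulVecLin) = 1 := by
    have h := L.mulVecLin.finrank_range_add_finrank_ker
    rw [← Matrix.rank, hrank, Module.finrank_fin_fun] at h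
    omega
  have hone : (⟨fun _ => 1, hL1⟩ : LinearMap.ker L.mulVecLin) ≠ 0 := fun h =>
    one_ne_zero (congrFun (congrArg Subtype.val h) 0)
  obtain ⟨c, hc⟩ := (finrank_eq_one_iff_of_nonzero' _ hone).1 hker ⟨v, hv⟩
  refine ⟨c, fun i => ?_⟩
  simpa using (congrFun (congrArg Subtype.val hc) i).symm

theorem pinv_mul_laplacian (n : ℕ) (L P : Matrix (Fin (n + 1)) (Fin (n + 1)) ℝ)
    (hL1 : L.mulVec (fun _ => 1) = 0) (hrank : L.rank = n)
    (h1 : L * P * L = L) (h2 : P * L * P = P)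
    (h3 : (L * P)ᵀ = L * P) (h4 : (P * L)ᵀ = P * L) :
    P * L = 1 - ((n + 1 : ℝ))⁻¹ • Matrix.of (fun _ _ => (1 : ℝ)) := by
  obtain ⟨Q, hQ⟩ : ∃ Q, Q = 1 - P * L := ⟨_, rfl⟩
  have hLQ : L * Q = 0 := by rw [hQ, mul_sub, mul_one, ← mul_assoc, h1, sub_self]
  have hsymm : Qᵀ = Q := by rw [hQ, transpose_sub, transpose_one, h4]
  have hQ1 : Q.mulVec (fun _ => 1) = fun _ => 1 := by
    rw [hQ, sub_mulVec, one_mulVec, ← mulVec_mulVec, hL1, mulVec_zero, sub_zero]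
  have hcol (j) : ∃ c, ∀ i, Q i j = c :=
    exists_const_of_mulVec_eq_zero hL1 hrank (v := fun i => Q i j)
      (funext fun i => congrFun (congrFun hLQ i) j)
  choose c hc using hcol
  have hconst (i j) : Q i j = c 0 := by
    rw [hc, ← hc j 0, ← hsymm, transpose_apply, hc]
  have hsum : (n + 1 : ℝ) * c 0 = 1 := by
    simpa [mulVec, dotProduct, hconst] using congrFun hQ1 0
  have hPL : P * L = 1 - Q := by rw [hQ, sub_sub_cancel]
  rw [hPL]
  congr 1
  ext i j
  simpa [hconst] using eq_inv_of_mul_eq_one_right hsum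
end

section
/- Let R ≥ 0, I ∈ ℝ, α > 0 and β > 0 be real numbers. Define X = α²·(R² − I²) + (2α² − 4β)·R + α² − 4β, Y = α²·R·I + (α² − 2β)·I, and k₁² = (1/2)·(X + √(X² + 4Y²)). Then k₁² < α²·(R + 1)² if and only if β·I² < α²·((R + 1)·I² + (R + 1)³). -/
theorem k1_sq_lt_iff_gain_condition (R I α β : ℝ) (hR : 0 ≤ R)
    (hα : 0 < α) (hβ : 0 < β) (X Y k₁sq : ℝ)
    (hX : X = α ^ 2 * (R ^ 2 - I ^ 2) + (2 * α ^ 2 - 4 * β) * R + α ^ 2 - 4 * β)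
    (hY : Y = α ^ 2 * R * I + (α ^ 2 - 2 * β) * I)
    (hk : k₁sq = (1 / 2) * (X + Real.sqrt (X ^ 2 + 4 * Y ^ 2))) :
    k₁sq < α ^ 2 * (R + 1) ^ 2 ↔
      β * I ^ 2 < α ^ 2 * ((R + 1) * I ^ 2 + (R + 1) ^ 3) := by
  have hpos : 0 < 2 * (α ^ 2 * (R + 1) ^ 2) - X := by
    have h : 2 * (α ^ 2 * (R + 1) ^ 2) - X
        = α ^ 2 * ((R + 1) ^ 2 + I ^ 2) + 4 * β * (R + 1) := by
      rw [hX]; ring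
    rw [h]; positivity
  have hdiff : (2 * (α ^ 2 * (R + 1) ^ 2) - X) ^ 2 - (X ^ 2 + 4 * Y ^ 2)
      = 16 * β * (α ^ 2 * ((R + 1) * I ^ 2 + (R + 1) ^ 3) - β * I ^ 2) := by
    rw [hX, hY]; ring
  have hsqrt : k₁sq < α ^ 2 * (R + 1) ^ 2 ↔
      Real.sqrt (X ^ 2 + 4 * Y ^ 2) < 2 * (α ^ 2 * (R + 1) ^ 2) - X := by
    rw [hk]; constructor <;> intro h <;> linarith
  rw [hsqrt, Real.sqrt_lt' hpos, ← sub_pos, hdiff, mul_pos_iff_of_pos_left (by positivity), sub_pos]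
end
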